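/- For every δ > 0 there exists a constant ε > 0 such that for every p ∈ (0,1] the following holds: every (p,λ)-bijumbled graph G on n vertices with n divisible by 3, λ ≤ ε p² n / log n, and minimum degree δ(G) ≥ δ p n contains a triangle-factor, i.e., a collection of n/3 vertex-disjoint triangles covering all vertices of G. -/

import Mathlib

open Finset

/-- The number of pairs `(a,b) ∈ A × B` with `ab` an edge of `G`
(edges inside `A ∩ B` are counted twice). -/
def ePairs {V : Type} [DecidableEq V] (G : SimpleGraph V) [DecidableRel G.Adj]
    (A B : Finset V) : ℕ :=
  ((A ×ˢ B).filter fun ab => G.Adj ab.1 ab.2).card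

/-- `G` is `(p,λ)`-bijumbled: `|e(A,B) − p|A||B|| < λ√(|A||B|)` for all (nonempty)
vertex subsets `A, B`. -/
def Bijumbled {V : Type} [Fintype V] [DecidableEq V] (G : SimpleGraph V)
    [DecidableRel G.Adj] (p lam : ℝ) : Prop :=
  ∀ A B : Finset V, A.Nonempty → B.Nonempty →
    |(ePairs G A B : ℝ) - p * A.card * B.card| < lam * Real.sqrt (A.card * B.card)


section Matching

variable {α β : Type*}

/-- `m` assigns to the elements of `A` pairwise disjoint hyperedges. -/
def IsDisjointChoice (E : α → Finset β → Prop) (A : Finset α) (m : α → Finset β) : Prop :=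
  (∀ a ∈ A, E a (m a)) ∧ ∀ a ∈ A, ∀ b ∈ A, a ≠ b → Disjoint (m a) (m b)

lemma IsDisjointChoice.update [DecidableEq α] {E : α → Finset β → Prop} {A : Finset α}
    {m : α → Finset β} {a : α} {f : Finset β} (hm : IsDisjointChoice E A m) (haf : E a f)
    (hf : ∀ b ∈ A, b ≠ a → Disjoint (m b) f) :
    IsDisjointChoice E (insert a A) (Function.update m a f) := by
  refine ⟨fun b hb => ?_, fun b hb c hc hbc => ?_⟩
  · by_cases hba : b = a
    · subst hba; simpa using haf
    · rw [Function.update_of_ne hba]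
      exact hm.1 b (Finset.mem_of_mem_insert_of_ne hb hba)
  · by_cases hba : b = a
    · subst hba
      rw [Function.update_self, Function.update_of_ne hbc.symm]
      exact (hf c (Finset.mem_of_mem_insert_of_ne hc hbc.symm) hbc.symm).symm
    · by_cases hca : c = a
      · subst hca
        rw [Function.update_self, Function.update_of_ne hba]
        exact hf b (Finset.mem_of_mem_insert_of_ne hb hba) hba
      · rw [Function.update_of_ne hba, Function.update_of_ne hca]
        exact hm.2 b (Finset.mem_of_mem_insert_of_ne hb hba) c
          (Finset.mem_of_mem_insert_of_ne hc hca) hbc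

/-- The augmentation step in Haxell's theorem: a disjoint choice on `A` can be changed outside
`S` so that some element of `insert a₀ S` has a hyperedge disjoint from all chosen ones. -/
lemma exists_free_hyperedge [DecidableEq α] [DecidableEq β] {E : α → Finset β → Prop}
    (hE : ∀ a f, E a f → f.card ≤ 2) {A : Finset α} {a₀ : α}
    (h : ∀ S ⊆ insert a₀ A, S.Nonempty → ∀ U : Finset β, U.card ≤ 4 * S.card →
      ∃ a ∈ S, ∃ f, E a f ∧ Disjoint f U) (k : ℕ) :
    ∀ (S : Finset α) (F : Finset β) (m : α → Finset β), S ⊆ A → (A \ S).card = k →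
      F.card ≤ 2 * S.card → IsDisjointChoice E A m → (∀ b ∈ A \ S, Disjoint (m b) F) →
      ∃ m' : α → Finset β, IsDisjointChoice E A m' ∧ (∀ b ∈ S, m' b = m b) ∧
        (∀ b ∈ A \ S, Disjoint (m' b) F) ∧
        ∃ a ∈ insert a₀ S, ∃ f, E a f ∧ Disjoint f F ∧ ∀ b ∈ A, Disjoint (m' b) f := by
  induction k using Nat.strong_induction_on with
  | _ k ih =>
  intro S F m₀ hSA hk hF hm₀ hm₀F
  obtain ⟨a, haS, f, haf, hfU⟩ := h (insert a₀ S) (Finset.insert_subset_insert _ hSA)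
    (Finset.insert_nonempty _ _) (F ∪ S.biUnion m₀) (by
      have h1 : (S.biUnion m₀).card ≤ S.card * 2 :=
        Finset.card_biUnion_le_card_mul _ _ _ fun b hb => hE b _ (hm₀.1 b (hSA hb))
      have h2 := Finset.card_union_le F (S.biUnion m₀)
      have h3 : S.card ≤ (insert a₀ S).card := Finset.card_le_card (Finset.subset_insert _ _)
      omega)
  rw [Finset.disjoint_union_right, Finset.disjoint_biUnion_right] at hfU
  obtain ⟨hfF, hfS⟩ := hfU
  have key : ∀ (j : ℕ) (m : α → Finset β), (A.filter fun b => ¬ Disjoint (m b) f).card = j →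
      IsDisjointChoice E A m → (∀ b ∈ S, m b = m₀ b) → (∀ b ∈ A \ S, Disjoint (m b) F) →
      ∃ m' : α → Finset β, IsDisjointChoice E A m' ∧ (∀ b ∈ S, m' b = m₀ b) ∧
        (∀ b ∈ A \ S, Disjoint (m' b) F) ∧
        ∃ a ∈ insert a₀ S, ∃ f, E a f ∧ Disjoint f F ∧ ∀ b ∈ A, Disjoint (m' b) f := by
    intro j
    induction j using Nat.strong_induction_on with
    | _ j ihj =>
    intro m hj hm hmS hmF
    set N := A.filter fun b => ¬ Disjoint (m b) f with hN
    rcases N.eq_empty_or_nonempty with hN0 | hN0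
    · refine ⟨m, hm, hmS, hmF, a, haS, f, haf, hfF, fun b hb => ?_⟩
      by_contra hcon
      have : b ∈ N := Finset.mem_filter.2 ⟨hb, hcon⟩
      simp [hN0] at this
    have hNA : N ⊆ A := Finset.filter_subset _ _
    have hNS : Disjoint S N := by
      rw [Finset.disjoint_left]
      intro b hbS hbN
      exact (Finset.mem_filter.1 hbN).2 (by rw [hmS b hbS]; exact (hfS b hbS).symm)
    have hcard : (S ∪ N).card = S.card + N.card := Finset.card_union_of_disjoint hNS
    have hNpos : 0 < N.card := hN0.card_pos
    obtain ⟨m₁, hm₁, hm₁S, hm₁F, a₁, ha₁, f₁, haf₁, hfF₁, hfree⟩ :=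
      ih (A \ (S ∪ N)).card (by
        rw [← hk, Finset.card_sdiff_of_subset hSA,
          Finset.card_sdiff_of_subset (Finset.union_subset hSA hNA)]
        have := Finset.card_le_card (Finset.union_subset hSA hNA)
        omega) (S ∪ N) (F ∪ f) m (Finset.union_subset hSA hNA) rfl (by
          have h1 := Finset.card_union_le F f
          have h2 := hE a f haf
          omega) hm (by
        intro b hb
        simp only [Finset.mem_sdiff, Finset.mem_union, not_or] at hb
        rw [Finset.disjoint_union_right]
        refine ⟨hmF b (Finset.mem_sdiff.2 ⟨hb.1, hb.2.1⟩), ?_⟩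
        by_contra hcon
        exact hb.2.2 (Finset.mem_filter.2 ⟨hb.1, hcon⟩))
    rw [Finset.disjoint_union_right] at hfF₁
    have hm₁F' : ∀ b ∈ A \ S, Disjoint (m₁ b) F := by
      intro b hb
      by_cases hbN : b ∈ N
      · rw [hm₁S b (Finset.mem_union_right _ hbN)]
        exact hmF b hb
      · have := hm₁F b (by
          simp only [Finset.mem_sdiff, Finset.mem_union, not_or] at hb ⊢
          exact ⟨hb.1, hb.2, hbN⟩)
        exact (Finset.disjoint_union_right.1 this).1
    have hm₁S' : ∀ b ∈ S, m₁ b = m₀ b := fun b hb =>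
      (hm₁S b (Finset.mem_union_left _ hb)).trans (hmS b hb)
    by_cases ha₁S : a₁ ∈ insert a₀ S
    · exact ⟨m₁, hm₁, hm₁S', hm₁F', a₁, ha₁S, f₁, haf₁, hfF₁.1, hfree⟩
    have ha₁N : a₁ ∈ N := by
      simp only [Finset.mem_insert, Finset.mem_union, not_or] at ha₁ ha₁S
      tauto
    have ha₁nS : a₁ ∉ S := fun hc => ha₁S (Finset.mem_insert_of_mem hc)
    have hm₂ := hm₁.update haf₁ fun b hb _ => hfree b hb
    rw [Finset.insert_eq_of_mem (hNA ha₁N)] at hm₂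
    refine ihj _ ?_ (Function.update m₁ a₁ f₁) rfl hm₂ ?_ ?_
    · rw [← hj]
      refine Finset.card_lt_card (Finset.ssubset_iff_subset_ne.2 ⟨fun b hb => ?_, fun heq => ?_⟩)
      · obtain ⟨hbA, hbf⟩ := Finset.mem_filter.1 hb
        by_cases hba : b = a₁
        · exact hba ▸ ha₁N
        · rw [Function.update_of_ne hba] at hbf
          by_contra hbN
          by_cases hbS : b ∈ S
          · exact hbf (by rw [hm₁S' b hbS]; exact (hfS b hbS).symm)
          · refine hbf (Finset.disjoint_union_right.1 (hm₁F b ?_)).2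
            simp only [Finset.mem_sdiff, Finset.mem_union, not_or]
            exact ⟨hbA, hbS, hbN⟩
      · rw [← heq] at ha₁N
        have := (Finset.mem_filter.1 ha₁N).2
        rw [Function.update_self] at this
        exact this hfF₁.2
    · intro b hb
      rw [Function.update_of_ne (by rintro rfl; exact ha₁nS hb)]
      exact hm₁S' b hb
    · intro b hb
      by_cases hba : b = a₁
      · subst hba; rw [Function.update_self]; exact hfF₁.1
      · rw [Function.update_of_ne hba]; exact hm₁F' b hb
  exact key _ m₀ rfl hm₀ (fun _ _ => rfl) hm₀F

/-- A case of Haxell's theorem on matchings in bipartite hypergraphs, for hyperedges with at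
most two vertices on the right-hand side. -/
theorem exists_isDisjointChoice [DecidableEq α] [DecidableEq β] {E : α → Finset β → Prop}
    (hE : ∀ a f, E a f → f.card ≤ 2) (A : Finset α)
    (h : ∀ S ⊆ A, S.Nonempty → ∀ U : Finset β, U.card ≤ 4 * S.card →
      ∃ a ∈ S, ∃ f, E a f ∧ Disjoint f U) :
    ∃ m : α → Finset β, IsDisjointChoice E A m := by
  induction A using Finset.induction_on with
  | empty => exact ⟨fun _ => ∅, by simp [IsDisjointChoice]⟩
  | insert a₀ A ha₀ ih =>
    obtain ⟨m, hm⟩ := ih fun S hS => h S (hS.trans (Finset.subset_insert _ _))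
    obtain ⟨m', hm', -, -, a, ha, f, haf, -, hfree⟩ :=
      exists_free_hyperedge hE h _ ∅ ∅ m (Finset.empty_subset _) rfl (by simp) hm (by simp)
    obtain rfl : a = a₀ := by simpa using ha
    exact ⟨_, hm'.update haf fun b hb _ => hfree b hb⟩

end Matching

section Tiling

variable {V : Type} [DecidableEq V] {G : SimpleGraph V}

/-- The vertex set `S` can be partitioned into triangles of `G`. -/
inductive TriangleTiled (G : SimpleGraph V) : Finset V → Prop
  | empty : TriangleTiled G ∅
  | union {S t : Finset V} : TriangleTiled G S → G.IsNClique 3 t → Disjoint S t →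
      TriangleTiled G (S ∪ t)

lemma TriangleTiled.disjoint_union {S T : Finset V} (hS : TriangleTiled G S)
    (hT : TriangleTiled G T) (h : Disjoint S T) : TriangleTiled G (S ∪ T) := by
  induction hT with
  | empty => simpa using hS
  | @union T t _ ht hTt ih =>
    rw [Finset.disjoint_union_right] at h
    rw [← Finset.union_assoc]
    exact (ih h.1).union ht (Finset.disjoint_union_left.2 ⟨h.2, hTt⟩)

lemma TriangleTiled.three_dvd_card {S : Finset V} (hS : TriangleTiled G S) : 3 ∣ S.card := by
  induction hS with
  | empty => simp
  | union _ ht h ih =>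
    rw [Finset.card_union_of_disjoint h, ht.card_eq]
    exact ih.add (dvd_refl 3)

lemma TriangleTiled.biUnion {ι : Type*} [DecidableEq ι] {I : Finset ι} {f : ι → Finset V}
    (hf : ∀ i ∈ I, TriangleTiled G (f i))
    (hd : ∀ i ∈ I, ∀ j ∈ I, i ≠ j → Disjoint (f i) (f j)) : TriangleTiled G (I.biUnion f) := by
  induction I using Finset.induction_on with
  | empty => simpa using TriangleTiled.empty
  | insert a I ha ih =>
    rw [Finset.biUnion_insert]
    refine (hf a (Finset.mem_insert_self _ _)).disjoint_union
      (ih (fun i hi => hf i (Finset.mem_insert_of_mem hi)) fun i hi j hj =>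
        hd i (Finset.mem_insert_of_mem hi) j (Finset.mem_insert_of_mem hj)) ?_
    rw [Finset.disjoint_biUnion_right]
    exact fun i hi => hd a (Finset.mem_insert_self _ _) i (Finset.mem_insert_of_mem hi)
      fun h => ha (h ▸ hi)

lemma TriangleTiled.exists_partition {S : Finset V} (hS : TriangleTiled G S) :
    ∃ P : Finset (Finset V), (∀ s ∈ P, G.IsNClique 3 s) ∧
      (P : Set (Finset V)).Pairwise (fun s t => Disjoint s t) ∧ P.biUnion id = S := by
  induction hS with
  | empty => exact ⟨∅, by simp⟩
  | @union S t _ ht h ih =>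
    obtain ⟨P, hP, hd, rfl⟩ := ih
    refine ⟨insert t P, ?_, ?_, ?_⟩
    · simpa [ht] using hP
    · rw [Finset.coe_insert]
      refine hd.insert fun s hs _ => ?_
      have := Finset.disjoint_of_subset_left (Finset.subset_biUnion_of_mem id hs) h
      exact ⟨this.symm, this⟩
    · rw [Finset.biUnion_insert, Finset.union_comm]; rfl

/-- A set `D` with `3|X| - 2` vertices that can be partitioned into triangles after the removal
of any single vertex of `X`. -/
structure IsFlexible (G : SimpleGraph V) (D X : Finset V) : Prop where
  subset : X ⊆ D
  card_eq : D.card + 2 = 3 * X.card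
  tiled : ∀ x ∈ X, TriangleTiled G (D.erase x)

lemma isFlexible_singleton (v : V) : IsFlexible G {v} {v} where
  subset := subset_rfl
  card_eq := by simp
  tiled x hx := by
    obtain rfl := Finset.mem_singleton.1 hx
    simpa using TriangleTiled.empty

lemma IsFlexible.nonempty {D X : Finset V} (h : IsFlexible G D X) : X.Nonempty := by
  have := h.card_eq
  exact Finset.card_pos.1 (by omega)

lemma IsFlexible.insert_diamond {D X : Finset V} (h : IsFlexible G D X) {x y z u : V}
    (hx : x ∈ X) (hy : y ∉ D) (hz : z ∉ D) (hu : u ∉ D) (hxy : G.Adj x y) (hxz : G.Adj x z)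
    (hyz : G.Adj y z) (huy : G.Adj u y) (huz : G.Adj u z) :
    IsFlexible G (D ∪ {u, y, z}) (insert u X) where
  subset := by
    intro v hv
    rcases Finset.mem_insert.1 hv with rfl | hv
    · simp
    · exact Finset.mem_union_left _ (h.subset hv)
  card_eq := by
    have hd : Disjoint D {u, y, z} := by simp [hy, hz, hu]
    have huX : u ∉ X := fun hc => hu (h.subset hc)
    have h3 : ({u, y, z} : Finset V).card = 3 :=
      Finset.card_eq_three.2 ⟨u, y, z, huy.ne, huz.ne, hyz.ne, rfl⟩
    rw [Finset.card_union_of_disjoint hd, Finset.card_insert_of_notMem huX, h3]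
    have := h.card_eq
    omega
  tiled v hv := by
    rcases Finset.mem_insert.1 hv with rfl | hv
    · have hxD := h.subset hx
      have heq : (D ∪ {v, y, z}).erase v = D.erase x ∪ {x, y, z} := by
        ext w
        simp only [Finset.mem_erase, Finset.mem_union, Finset.mem_insert, Finset.mem_singleton]
        constructor
        · rintro ⟨h1, h2 | h2 | h2 | h2⟩ <;> by_cases hwx : w = x <;> simp_all
        · rintro (⟨h1, h2⟩ | rfl | rfl | rfl)
          · exact ⟨fun hc => hu (hc ▸ h2), Or.inl h2⟩
          · exact ⟨fun hc => hu (hc ▸ hxD), Or.inl hxD⟩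
          · exact ⟨huy.ne', by simp⟩
          · exact ⟨huz.ne', by simp⟩
      rw [heq]
      refine (h.tiled x hx).union
        (SimpleGraph.is3Clique_iff.2 ⟨x, y, z, hxy, hxz, hyz, rfl⟩) ?_
      simp [hy, hz]
    · have hvD := h.subset hv
      have heq : (D ∪ {u, y, z}).erase v = D.erase v ∪ {u, y, z} := by
        rw [Finset.erase_union_distrib, Finset.erase_eq_of_notMem (s := {u, y, z})]
        simp only [Finset.mem_insert, Finset.mem_singleton, not_or]
        exact ⟨fun hc => hu (hc ▸ hvD), fun hc => hy (hc ▸ hvD), fun hc => hz (hc ▸ hvD)⟩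
      rw [heq]
      refine (h.tiled v hv).union
        (SimpleGraph.is3Clique_iff.2 ⟨u, y, z, huy, huz, hyz, rfl⟩) ?_
      simp [hy, hz, hu]

/-- Three disjoint flexible sets joined by a transversal triangle can be tiled. -/
lemma IsFlexible.tiled_of_triangle {D₁ X₁ D₂ X₂ D₃ X₃ : Finset V} (h₁ : IsFlexible G D₁ X₁)
    (h₂ : IsFlexible G D₂ X₂) (h₃ : IsFlexible G D₃ X₃) (h₁₂ : Disjoint D₁ D₂)
    (h₁₃ : Disjoint D₁ D₃) (h₂₃ : Disjoint D₂ D₃) {x y z : V} (hx : x ∈ X₁) (hy : y ∈ X₂)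
    (hz : z ∈ X₃) (hxy : G.Adj x y) (hxz : G.Adj x z) (hyz : G.Adj y z) :
    TriangleTiled G (D₁ ∪ (D₂ ∪ D₃)) := by
  have hx' := h₁.subset hx
  have hy' := h₂.subset hy
  have hz' := h₃.subset hz
  have heq : D₁ ∪ (D₂ ∪ D₃) = (D₁.erase x ∪ (D₂.erase y ∪ D₃.erase z)) ∪ {x, y, z} := by
    ext w
    simp only [Finset.mem_erase, Finset.mem_union, Finset.mem_insert, Finset.mem_singleton]
    by_cases h1 : w = x <;> by_cases h2 : w = y <;> by_cases h3 : w = z <;> simp_all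
  have hd {A B : Finset V} (a b : V) (h : Disjoint A B) : Disjoint (A.erase a) (B.erase b) :=
    h.mono (Finset.erase_subset _ _) (Finset.erase_subset _ _)
  rw [heq]
  refine ((h₁.tiled x hx).disjoint_union ((h₂.tiled y hy).disjoint_union (h₃.tiled z hz)
    (hd _ _ h₂₃)) (Finset.disjoint_union_right.2 ⟨hd _ _ h₁₂, hd _ _ h₁₃⟩)).union
    (SimpleGraph.is3Clique_iff.2 ⟨x, y, z, hxy, hxz, hyz, rfl⟩) ?_
  rw [Finset.disjoint_left] at h₁₂ h₁₃ h₂₃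
  rw [Finset.disjoint_right]
  intro w hw hw'
  simp only [Finset.mem_erase, Finset.mem_union, Finset.mem_insert, Finset.mem_singleton]
    at hw hw'
  rcases hw with rfl | rfl | rfl
  · rcases hw' with h | h | h
    · exact h.1 rfl
    · exact h₁₂ hx' h.2
    · exact h₁₃ hx' h.2
  · rcases hw' with h | h | h
    · exact h₁₂ h.2 hy'
    · exact h.1 rfl
    · exact h₂₃ hy' h.2
  · rcases hw' with h | h | h
    · exact h₁₃ h.2 hz'
    · exact h₂₃ h.2 hz'
    · exact h.1 rfl

end Tiling

section Jumbled

variable {V : Type} {G : SimpleGraph V}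

/-- `x` is a tip of a diamond whose other three vertices lie in `F`. -/
def HasDiamond (G : SimpleGraph V) (x : V) (F : Finset V) : Prop :=
  ∃ y ∈ F, ∃ z ∈ F, ∃ u ∈ F, G.Adj x y ∧ G.Adj x z ∧ G.Adj y z ∧ G.Adj u y ∧ G.Adj u z

lemma HasDiamond.mono {x : V} {F F' : Finset V} (h : HasDiamond G x F) (hF : F ⊆ F') :
    HasDiamond G x F' := by
  obtain ⟨y, hy, z, hz, u, hu, h⟩ := h
  exact ⟨y, hF hy, z, hF hz, u, hF hu, h⟩

variable [DecidableRel G.Adj]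

/-- The neighbours of `x` in `Y`. -/
def nbrs (G : SimpleGraph V) [DecidableRel G.Adj] (x : V) (Y : Finset V) : Finset V :=
  Y.filter (G.Adj x)

lemma mem_nbrs {x y : V} {Y : Finset V} : y ∈ nbrs G x Y ↔ y ∈ Y ∧ G.Adj x y :=
  Finset.mem_filter

variable [DecidableEq V]

lemma card_nbrs_le_add_sdiff (x : V) (Y U : Finset V) :
    (nbrs G x Y).card ≤ (nbrs G x (Y \ U)).card + (nbrs G x U).card := by
  refine (Finset.card_le_card fun y hy => ?_).trans (Finset.card_union_le _ _)
  rw [mem_nbrs] at hy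
  by_cases hyU : y ∈ U
  · exact Finset.mem_union_right _ (mem_nbrs.2 ⟨hyU, hy.2⟩)
  · exact Finset.mem_union_left _ (mem_nbrs.2 ⟨Finset.mem_sdiff.2 ⟨hy.1, hyU⟩, hy.2⟩)

lemma ePairs_eq_sum (A B : Finset V) : ePairs G A B = ∑ a ∈ A, (nbrs G a B).card := by
  simp only [ePairs, nbrs, Finset.card_filter, Finset.sum_product]

variable [Fintype V] {p lam : ℝ}

lemma Bijumbled.card_low_degree (hG : Bijumbled G p lam) (hp : 0 < p) {B Y : Finset V}
    (h : ∀ b ∈ B, ((nbrs G b Y).card : ℝ) ≤ p * Y.card / 2) :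
    p ^ 2 * B.card * Y.card ≤ 4 * lam ^ 2 := by
  rcases B.eq_empty_or_nonempty with rfl | hB
  · simp; positivity
  rcases Y.eq_empty_or_nonempty with rfl | hY
  · simp; positivity
  have hB' : (0 : ℝ) < B.card := by exact_mod_cast hB.card_pos
  have hY' : (0 : ℝ) < Y.card := by exact_mod_cast hY.card_pos
  have he : (ePairs G B Y : ℝ) ≤ B.card * (p * Y.card / 2) := by
    rw [ePairs_eq_sum, Nat.cast_sum, ← nsmul_eq_mul]
    exact Finset.sum_le_card_nsmul _ _ _ h
  have h1 := (abs_lt.1 (hG B Y hB hY)).1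
  set q := Real.sqrt (B.card * Y.card) with hq
  have hq0 : 0 < q := Real.sqrt_pos.2 (by positivity)
  have hq2 : q ^ 2 = B.card * Y.card := Real.sq_sqrt (by positivity)
  have h2 : q * (p * q) < q * (2 * lam) := by nlinarith
  have h3 : p * q < 2 * lam := lt_of_mul_lt_mul_left h2 hq0.le
  have h4 : (p * q) ^ 2 ≤ (2 * lam) ^ 2 := pow_le_pow_left₀ (by positivity) h3.le 2
  nlinarith

lemma Bijumbled.card_high_degree (hG : Bijumbled G p lam) {B U : Finset V} {d : ℝ}
    (hd : 0 < d) (hdU : 2 * p * U.card ≤ d) (h : ∀ b ∈ B, d ≤ ((nbrs G b U).card : ℝ)) :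
    B.card * d ^ 2 ≤ 4 * lam ^ 2 * U.card := by
  rcases B.eq_empty_or_nonempty with rfl | hB
  · simp; positivity
  rcases U.eq_empty_or_nonempty with rfl | hU
  · obtain ⟨b, hb⟩ := hB
    have := h b hb
    simp [nbrs] at this
    linarith
  have hB' : (0 : ℝ) < B.card := by exact_mod_cast hB.card_pos
  have hU' : (0 : ℝ) < U.card := by exact_mod_cast hU.card_pos
  have he : B.card * d ≤ (ePairs G B U : ℝ) := by
    rw [ePairs_eq_sum, Nat.cast_sum, ← nsmul_eq_mul]
    exact Finset.card_nsmul_le_sum _ _ _ h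
  have h1 := (abs_lt.1 (hG B U hB hU)).2
  set q := Real.sqrt (B.card * U.card) with hq
  have hq0 : 0 < q := Real.sqrt_pos.2 (by positivity)
  have hq2 : q ^ 2 = B.card * U.card := Real.sq_sqrt (by positivity)
  have h2 : B.card * d < 2 * lam * q := by nlinarith
  have h3 : (B.card * d) ^ 2 ≤ (2 * lam * q) ^ 2 :=
    pow_le_pow_left₀ (by positivity) h2.le 2
  refine le_of_mul_le_mul_left ?_ hB'
  calc (B.card : ℝ) * (B.card * d ^ 2) = (B.card * d) ^ 2 := by ring
    _ ≤ (2 * lam * q) ^ 2 := h3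
    _ = B.card * (4 * lam ^ 2 * U.card) := by rw [mul_pow, hq2]; ring

lemma Bijumbled.exists_adj (hG : Bijumbled G p lam) (hp : 0 < p) (hlam : 0 < lam)
    {A B : Finset V} {s : ℝ} (hs : lam ≤ p * s) (hA : s ≤ A.card) (hB : s ≤ B.card) :
    ∃ a ∈ A, ∃ b ∈ B, G.Adj a b := by
  by_contra! hcon
  have hs0 : 0 < s := pos_of_mul_pos_right (hlam.trans_le hs) hp.le
  have hA' : (0 : ℝ) < A.card := hs0.trans_le hA
  have hB' : (0 : ℝ) < B.card := hs0.trans_le hB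
  have he : ePairs G A B = 0 := by
    rw [ePairs, Finset.card_eq_zero, Finset.filter_eq_empty_iff]
    intro x hx
    exact hcon _ (Finset.mem_product.1 hx).1 _ (Finset.mem_product.1 hx).2
  have h1 := (abs_lt.1 (hG A B (Finset.card_pos.1 (by exact_mod_cast hA'))
    (Finset.card_pos.1 (by exact_mod_cast hB')))).1
  rw [he] at h1
  set q := Real.sqrt (A.card * B.card) with hq
  have hq2 : q ^ 2 = A.card * B.card := Real.sq_sqrt (by positivity)
  have hsq : s ≤ q := Real.le_sqrt_of_sq_le (by nlinarith)
  push_cast at h1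
  nlinarith [mul_le_mul_of_nonneg_left hsq hp.le, hs0.trans_le hsq]

variable {τ : ℕ}

lemma Bijumbled.exists_typical (hG : Bijumbled G p lam) (hp : 0 < p) (hp1 : p ≤ 1)
    (hlam : 0 < lam) (hτ : 4 * lam ≤ p ^ 2 * τ) {A B C : Finset V} (hA : τ ≤ A.card)
    (hB : τ ≤ B.card) (hC : τ ≤ C.card) :
    ∃ a ∈ A, p * τ / 2 ≤ (nbrs G a B).card ∧ p * τ / 2 ≤ (nbrs G a C).card := by
  have hτ0 : (0 : ℝ) < τ :=
    pos_of_mul_pos_right (lt_of_lt_of_le (by positivity) hτ) (by positivity)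
  have hbound : ∀ Y : Finset V, τ ≤ Y.card →
      2 * ((A.filter fun a => ((nbrs G a Y).card : ℝ) < p * τ / 2).card : ℝ) < τ := by
    intro Y hY
    set D := A.filter fun a => ((nbrs G a Y).card : ℝ) < p * τ / 2 with hD
    have hY' : (τ : ℝ) ≤ Y.card := by exact_mod_cast hY
    have h1 := hG.card_low_degree hp (B := D) (Y := Y) fun b hb => by
      have := (Finset.mem_filter.1 hb).2
      nlinarith [mul_le_mul_of_nonneg_left hY' hp.le]
    have h2 : p ^ 2 * D.card * τ ≤ 4 * lam ^ 2 := le_trans (by gcongr) h1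
    have h3 : (4 * lam) ^ 2 ≤ (p ^ 2 * τ) ^ 2 := pow_le_pow_left₀ (by positivity) hτ 2
    have h4 : p ^ 2 * (p ^ 2 * τ ^ 2) ≤ p ^ 2 * (1 * τ ^ 2) := by
      gcongr; exact pow_le_one₀ hp.le hp1
    have h5 : (p ^ 2 * τ) * (16 * D.card) ≤ (p ^ 2 * τ) * (4 * τ) := by nlinarith
    have h6 := le_of_mul_le_mul_left h5 (by positivity)
    linarith
  by_contra! hcon
  have hsub : A ⊆ (A.filter fun a => ((nbrs G a B).card : ℝ) < p * τ / 2) ∪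
      (A.filter fun a => ((nbrs G a C).card : ℝ) < p * τ / 2) := by
    intro a ha
    rw [Finset.mem_union, Finset.mem_filter, Finset.mem_filter]
    by_cases h : p * τ / 2 ≤ ((nbrs G a B).card : ℝ)
    · exact Or.inr ⟨ha, hcon a ha h⟩
    · exact Or.inl ⟨ha, not_le.1 h⟩
  have h1 : (A.card : ℝ) ≤ (A.filter fun a => ((nbrs G a B).card : ℝ) < p * τ / 2).card +
      (A.filter fun a => ((nbrs G a C).card : ℝ) < p * τ / 2).card := by
    exact_mod_cast (Finset.card_le_card hsub).trans (Finset.card_union_le _ _)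
  have hA' : (τ : ℝ) ≤ A.card := by exact_mod_cast hA
  linarith [hbound B hB, hbound C hC]

/-- A vertex with at least `pτ/3` neighbours in each of two sets spans a triangle with them. -/
lemma Bijumbled.exists_adj_nbrs (hG : Bijumbled G p lam) (hp : 0 < p) (hlam : 0 < lam)
    (hτ : 4 * lam ≤ p ^ 2 * τ) {x : V} {B C : Finset V}
    (hB : p * τ / 3 ≤ (nbrs G x B).card) (hC : p * τ / 3 ≤ (nbrs G x C).card) :
    ∃ y ∈ B, ∃ z ∈ C, G.Adj x y ∧ G.Adj x z ∧ G.Adj y z := by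
  obtain ⟨y, hy, z, hz, hyz⟩ := hG.exists_adj hp hlam (s := p * τ / 3) (by nlinarith) hB hC
  rw [mem_nbrs] at hy hz
  exact ⟨y, hy.1, z, hz.1, hy.2, hz.2, hyz⟩

lemma Bijumbled.exists_triangle (hG : Bijumbled G p lam) (hp : 0 < p) (hp1 : p ≤ 1)
    (hlam : 0 < lam) (hτ : 4 * lam ≤ p ^ 2 * τ) {A B C : Finset V} (hA : τ ≤ A.card)
    (hB : τ ≤ B.card) (hC : τ ≤ C.card) :
    ∃ x ∈ A, ∃ y ∈ B, ∃ z ∈ C, G.Adj x y ∧ G.Adj x z ∧ G.Adj y z := by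
  obtain ⟨x, hx, hxB, hxC⟩ := hG.exists_typical hp hp1 hlam hτ hA hB hC
  have : 0 ≤ p * τ := by positivity
  exact ⟨x, hx, hG.exists_adj_nbrs hp hlam hτ (by linarith) (by linarith)⟩

lemma Bijumbled.exists_hasDiamond (hG : Bijumbled G p lam) (hp : 0 < p) (hp1 : p ≤ 1)
    (hlam : 0 < lam) (hτ : 4 * lam ≤ p ^ 2 * τ) {B F : Finset V} (hB : τ ≤ B.card)
    (hF : τ ≤ F.card) : ∃ x ∈ B, HasDiamond G x F := by
  obtain ⟨y, hy, hyB, hyF⟩ := hG.exists_typical hp hp1 hlam hτ hF hB hF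
  have hpτ : 0 ≤ p * τ := by positivity
  have hbound : ∀ P : Finset V, p * τ / 2 ≤ P.card →
      (((nbrs G y F).filter fun z => ∀ x ∈ P, ¬ G.Adj z x).card : ℝ) < p * τ / 4 := by
    intro P hP
    by_contra! hcon
    obtain ⟨z, hz, x, hx, hzx⟩ := hG.exists_adj hp hlam (s := p * τ / 4) (by nlinarith) hcon
      (show _ ≤ (P.card : ℝ) by linarith)
    exact (Finset.mem_filter.1 hz).2 x hx hzx
  by_contra! hcon
  have hsub : nbrs G y F ⊆ ((nbrs G y F).filter fun z => ∀ x ∈ nbrs G y B, ¬ G.Adj z x) ∪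
      ((nbrs G y F).filter fun z => ∀ x ∈ nbrs G y F, ¬ G.Adj z x) := by
    intro z hz
    rw [Finset.mem_union, Finset.mem_filter, Finset.mem_filter]
    by_cases h : ∀ x ∈ nbrs G y B, ¬ G.Adj z x
    · exact Or.inl ⟨hz, h⟩
    push Not at h
    obtain ⟨x, hx, hzx⟩ := h
    refine Or.inr ⟨hz, fun u hu hzu => hcon x (mem_nbrs.1 hx).1 ?_⟩
    rw [mem_nbrs] at hx hu hz
    exact ⟨y, hy, z, hz.1, u, hu.1, hx.2.symm, hzx.symm, hz.2, hu.2.symm, hzu.symm⟩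
  have h1 : ((nbrs G y F).card : ℝ) ≤
      ((nbrs G y F).filter fun z => ∀ x ∈ nbrs G y B, ¬ G.Adj z x).card +
      ((nbrs G y F).filter fun z => ∀ x ∈ nbrs G y F, ¬ G.Adj z x).card := by
    exact_mod_cast (Finset.card_le_card hsub).trans (Finset.card_union_le _ _)
  linarith [hbound _ hyB, hbound _ hyF]

end Jumbled

section Orchard

variable {V : Type} [DecidableEq V] {G : SimpleGraph V}

/-- A family of pairs `(D, X)` with the `D` disjoint, each `D` flexible with respect to `X`, and
each `X` of size `M`. -/
structure IsOrchard (G : SimpleGraph V) (M : ℕ) (O : Finset (Finset V × Finset V)) : Prop where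
  flexible : ∀ t ∈ O, IsFlexible G t.1 t.2
  card_eq : ∀ t ∈ O, t.2.card = M
  disjoint : ∀ s ∈ O, ∀ t ∈ O, s ≠ t → Disjoint s.1 t.1

/-- All vertices of an orchard. -/
def verts (O : Finset (Finset V × Finset V)) : Finset V := O.biUnion Prod.fst

/-- The removable vertices of an orchard. -/
def tips (O : Finset (Finset V × Finset V)) : Finset V := O.biUnion Prod.snd

lemma mem_verts {O : Finset (Finset V × Finset V)} {v : V} : v ∈ verts O ↔ ∃ t ∈ O, v ∈ t.1 :=
  Finset.mem_biUnion

lemma mem_tips {O : Finset (Finset V × Finset V)} {v : V} : v ∈ tips O ↔ ∃ t ∈ O, v ∈ t.2 :=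
  Finset.mem_biUnion

lemma verts_mono {O O' : Finset (Finset V × Finset V)} (h : O ⊆ O') : verts O ⊆ verts O' :=
  Finset.biUnion_subset_biUnion_of_subset_left _ h

lemma verts_union (O O' : Finset (Finset V × Finset V)) : verts (O ∪ O') = verts O ∪ verts O' :=
  Finset.union_biUnion

lemma verts_sdiff_union {O R : Finset (Finset V × Finset V)} (h : R ⊆ O) :
    verts (O \ R) ∪ verts R = verts O := by
  rw [← verts_union, Finset.sdiff_union_of_subset h]

namespace IsOrchard

variable {M : ℕ} {O : Finset (Finset V × Finset V)}

lemma mono (hO : IsOrchard G M O) {O' : Finset (Finset V × Finset V)} (h : O' ⊆ O) :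
    IsOrchard G M O' :=
  ⟨fun t ht => hO.flexible t (h ht), fun t ht => hO.card_eq t (h ht),
    fun s hs t ht => hO.disjoint s (h hs) t (h ht)⟩

lemma tips_subset_verts (hO : IsOrchard G M O) : tips O ⊆ verts O := by
  intro v hv
  obtain ⟨t, ht, hvt⟩ := mem_tips.1 hv
  exact mem_verts.2 ⟨t, ht, (hO.flexible t ht).subset hvt⟩

lemma card_tips (hO : IsOrchard G M O) : (tips O).card = O.card * M := by
  rw [tips, Finset.card_biUnion, Finset.sum_const_nat hO.card_eq]
  intro s hs t ht hst
  exact (hO.disjoint s hs t ht hst).mono (hO.flexible s hs).subset (hO.flexible t ht).subset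

lemma card_verts (hO : IsOrchard G M O) : (verts O).card + 2 * O.card = 3 * (O.card * M) := by
  rw [verts, Finset.card_biUnion hO.disjoint, mul_comm 2, ← smul_eq_mul, ← Finset.sum_const,
    ← Finset.sum_add_distrib, Finset.sum_const_nat (m := 3 * M)]
  · ring
  · intro t ht
    rw [(hO.flexible t ht).card_eq, hO.card_eq t ht]

lemma disjoint_verts (hO : IsOrchard G M O) {O₁ O₂ : Finset (Finset V × Finset V)}
    (h₁ : O₁ ⊆ O) (h₂ : O₂ ⊆ O) (h : Disjoint O₁ O₂) : Disjoint (verts O₁) (verts O₂) := by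
  rw [verts, verts, Finset.disjoint_biUnion_left]
  intro s hs
  rw [Finset.disjoint_biUnion_right]
  intro t ht
  refine hO.disjoint s (h₁ hs) t (h₂ ht) ?_
  rintro rfl
  exact Finset.disjoint_left.1 h hs ht

lemma tiled_of_triangle (hO : IsOrchard G M O) {a b c : Finset V × Finset V} (ha : a ∈ O)
    (hb : b ∈ O) (hc : c ∈ O) (hab : a ≠ b) (hac : a ≠ c) (hbc : b ≠ c) {x y z : V}
    (hx : x ∈ a.2) (hy : y ∈ b.2) (hz : z ∈ c.2) (hxy : G.Adj x y) (hxz : G.Adj x z)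
    (hyz : G.Adj y z) : TriangleTiled G (verts {a, b, c}) := by
  rw [verts, Finset.biUnion_insert, Finset.biUnion_insert, Finset.singleton_biUnion]
  exact (hO.flexible a ha).tiled_of_triangle (hO.flexible b hb) (hO.flexible c hc)
    (hO.disjoint a ha b hb hab) (hO.disjoint a ha c hc hac) (hO.disjoint b hb c hc hbc)
    hx hy hz hxy hxz hyz

end IsOrchard

/-- The vertices of `S`, as an orchard. -/
def singletons (S : Finset V) : Finset (Finset V × Finset V) := S.image fun v => ({v}, {v})

lemma verts_singletons (S : Finset V) : verts (singletons S) = S := by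
  ext v; simp [mem_verts, singletons]

lemma tips_singletons (S : Finset V) : tips (singletons S) = S := by
  ext v; simp [mem_tips, singletons]

lemma isOrchard_singletons (S : Finset V) : IsOrchard G 1 (singletons S) where
  flexible t ht := by
    obtain ⟨v, -, rfl⟩ := Finset.mem_image.1 ht
    exact isFlexible_singleton v
  card_eq t ht := by
    obtain ⟨v, -, rfl⟩ := Finset.mem_image.1 ht
    simp
  disjoint s hs t ht hst := by
    obtain ⟨v, -, rfl⟩ := Finset.mem_image.1 hs
    obtain ⟨w, -, rfl⟩ := Finset.mem_image.1 ht
    rw [Finset.disjoint_singleton]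
    rintro rfl
    exact hst rfl

lemma singletons_union (S T : Finset V) : singletons (S ∪ T) = singletons S ∪ singletons T :=
  Finset.image_union _ _

lemma disjoint_singletons {S T : Finset V} (h : Disjoint S T) :
    Disjoint (singletons S) (singletons T) := by
  rw [Finset.disjoint_left]
  intro t hs ht
  obtain ⟨v, hv, rfl⟩ := Finset.mem_image.1 hs
  obtain ⟨w, hw, hvw⟩ := Finset.mem_image.1 ht
  simp only [Prod.mk.injEq, Finset.singleton_inj, and_self] at hvw
  exact Finset.disjoint_left.1 h hv (hvw ▸ hw)

variable [DecidableRel G.Adj] [Fintype V] {p lam : ℝ} {τ : ℕ}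

lemma Bijumbled.exists_isFlexible (hG : Bijumbled G p lam) (hp : 0 < p) (hp1 : p ≤ 1)
    (hlam : 0 < lam) (hτ : 4 * lam ≤ p ^ 2 * τ) {M : ℕ} (hM : 1 ≤ M) {Y : Finset V}
    (hY : 4 * τ + 3 * M ≤ Y.card) :
    ∃ D ⊆ Y, ∃ X, IsFlexible G D X ∧ X.card = M := by
  classical
  obtain ⟨D, hDmem, hDmax⟩ := Finset.exists_max_image
    (Y.powerset.filter fun D => D.card ≤ 3 * τ ∧
      ∃ X ⊆ D, D.card ≤ 3 * X.card ∧ ∀ x ∈ X, ¬ HasDiamond G x (Y \ D)) Finset.card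
    ⟨∅, by simp⟩
  simp only [Finset.mem_filter, Finset.mem_powerset] at hDmem hDmax
  obtain ⟨hDY, hDτ, X, hXD, hDX, hX⟩ := hDmem
  have key : ∀ k, 1 ≤ k → k ≤ M → ∃ D₁ ⊆ Y \ D, ∃ X₁, IsFlexible G D₁ X₁ ∧ X₁.card = k := by
    intro k hk
    induction k, hk using Nat.le_induction with
    | base =>
      intro _
      have hcard := Finset.le_card_sdiff D Y
      obtain ⟨v, hv⟩ := Finset.card_pos.1 (show 0 < (Y \ D).card by omega)
      exact ⟨{v}, by simpa using hv, {v}, isFlexible_singleton v, by simp⟩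
    | succ k hk ih =>
      intro hkM
      obtain ⟨D₁, hD₁, X₁, hfl, hX₁⟩ := ih (by omega)
      have hdis : Disjoint D D₁ := Finset.disjoint_of_subset_right hD₁ Finset.disjoint_sdiff
      by_cases hex : ∃ x ∈ X₁, HasDiamond G x (Y \ (D ∪ D₁))
      · obtain ⟨x, hx, y, hy, z, hz, u, hu, hxy, hxz, hyz, huy, huz⟩ := hex
        have hmem : ∀ {v}, v ∈ Y \ (D ∪ D₁) → v ∈ Y \ D ∧ v ∉ D₁ := by
          intro v hv
          simp only [Finset.mem_sdiff, Finset.mem_union, not_or] at hv ⊢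
          tauto
        refine ⟨D₁ ∪ {u, y, z}, ?_, insert u X₁, hfl.insert_diamond hx (hmem hy).2 (hmem hz).2
          (hmem hu).2 hxy hxz hyz huy huz, ?_⟩
        · refine Finset.union_subset hD₁ ?_
          intro v hv
          simp only [Finset.mem_insert, Finset.mem_singleton] at hv
          rcases hv with rfl | rfl | rfl
          exacts [(hmem hu).1, (hmem hy).1, (hmem hz).1]
        · rw [Finset.card_insert_of_notMem fun hc => (hmem hu).2 (hfl.subset hc), hX₁]
      · exfalso
        push Not at hex
        have hc₁ := hfl.card_eq
        have hcX : (X ∪ X₁).card = X.card + X₁.card :=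
          Finset.card_union_of_disjoint (hdis.mono hXD hfl.subset)
        have hcD : (D ∪ D₁).card = D.card + D₁.card := Finset.card_union_of_disjoint hdis
        have hdead : ∀ x ∈ X ∪ X₁, ¬ HasDiamond G x (Y \ (D ∪ D₁)) := by
          intro x hx hd
          rcases Finset.mem_union.1 hx with hx | hx
          · exact hX x hx (hd.mono
              (Finset.sdiff_subset_sdiff subset_rfl Finset.subset_union_left))
          · exact hex x hx hd
        have hsmall : (X ∪ X₁).card < τ := by
          by_contra! hbig
          have h1 := Finset.le_card_sdiff (D ∪ D₁) Y
          obtain ⟨x, hx, hd⟩ := hG.exists_hasDiamond hp hp1 hlam hτ hbig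
            (F := Y \ (D ∪ D₁)) (by omega)
          exact hdead x hx hd
        have := hDmax (D ∪ D₁) ⟨Finset.union_subset hDY (hD₁.trans Finset.sdiff_subset),
          by omega, X ∪ X₁, Finset.union_subset_union hXD hfl.subset, by omega, hdead⟩
        omega
  obtain ⟨D₁, hD₁, X₁, h⟩ := key M hM le_rfl
  exact ⟨D₁, hD₁.trans Finset.sdiff_subset, X₁, h⟩

lemma Bijumbled.exists_isOrchard (hG : Bijumbled G p lam) (hp : 0 < p) (hp1 : p ≤ 1)
    (hlam : 0 < lam) (hτ : 4 * lam ≤ p ^ 2 * τ) {M : ℕ} (hM : 1 ≤ M) {Y : Finset V} (N : ℕ)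
    (hY : 4 * τ + 3 * (N * M) ≤ Y.card) :
    ∃ O, IsOrchard G M O ∧ O.card = N ∧ verts O ⊆ Y := by
  induction N with
  | zero => exact ⟨∅, ⟨by simp, by simp, by simp⟩, by simp, by simp [verts]⟩
  | succ N ih =>
    rw [add_one_mul] at hY
    obtain ⟨O, hO, hON, hOY⟩ := ih (by omega)
    have hv := hO.card_verts
    have hc := Finset.le_card_sdiff (verts O) Y
    rw [hON] at hv
    obtain ⟨D, hD, X, hfl, hX⟩ := hG.exists_isFlexible hp hp1 hlam hτ hM
      (Y := Y \ verts O) (by omega)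
    have hdis : ∀ t ∈ O, Disjoint D t.1 := fun t ht =>
      Finset.disjoint_of_subset_left hD (Finset.disjoint_of_subset_right
        (Finset.subset_biUnion_of_mem Prod.fst ht) Finset.sdiff_disjoint)
    refine ⟨insert (D, X) O, ⟨?_, ?_, ?_⟩, ?_, ?_⟩
    · simpa [hfl] using hO.flexible
    · simpa [hX] using hO.card_eq
    · intro s hs t ht hst
      rcases Finset.mem_insert.1 hs with rfl | hs <;> rcases Finset.mem_insert.1 ht with rfl | ht
      · exact absurd rfl hst
      · exact hdis t ht
      · exact (hdis s hs).symm
      · exact hO.disjoint s hs t ht hst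
    · rw [Finset.card_insert_of_notMem, hON]
      intro hmem
      obtain ⟨x, hx⟩ := hfl.nonempty
      exact Finset.disjoint_left.1 (hdis _ hmem) (hfl.subset hx) (hfl.subset hx)
    · rw [verts, Finset.biUnion_insert]
      exact Finset.union_subset (hD.trans Finset.sdiff_subset) hOY

/-- All but few members of an orchard can be covered greedily. -/
lemma Bijumbled.exists_leftover (hG : Bijumbled G p lam) (hp : 0 < p) (hp1 : p ≤ 1)
    (hlam : 0 < lam) (hτ : 4 * lam ≤ p ^ 2 * τ) {M : ℕ} {O : Finset (Finset V × Finset V)}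
    (hO : IsOrchard G M O) :
    ∃ R ⊆ O, (R.card ≤ 2 ∨ R.card * M < 5 * τ) ∧ TriangleTiled G (verts (O \ R)) := by
  induction hn : O.card using Nat.strong_induction_on generalizing O with
  | _ n ih =>
  by_cases hsmall : O.card ≤ 2 ∨ O.card * M < 5 * τ
  · exact ⟨O, subset_rfl, hsmall, by simpa [verts] using TriangleTiled.empty⟩
  push Not at hsmall
  obtain ⟨h3, h5⟩ := hsmall
  set k := O.card / 3 with hk
  have hkM : τ ≤ k * M := by
    have : O.card * M ≤ 5 * k * M := Nat.mul_le_mul_right _ (by omega)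
    nlinarith
  obtain ⟨O₁, hO₁, hc₁⟩ := Finset.exists_subset_card_eq (s := O) (n := k) (by omega)
  have hs₁ := Finset.card_sdiff_of_subset hO₁
  obtain ⟨O₂, hO₂, hc₂⟩ := Finset.exists_subset_card_eq (s := O \ O₁) (n := k) (by omega)
  have hs₂ := Finset.card_sdiff_of_subset hO₂
  obtain ⟨O₃, hO₃, hc₃⟩ := Finset.exists_subset_card_eq (s := (O \ O₁) \ O₂) (n := k) (by omega)
  have hO₂' : O₂ ⊆ O := hO₂.trans Finset.sdiff_subset
  have hO₃' : O₃ ⊆ O := (hO₃.trans Finset.sdiff_subset).trans Finset.sdiff_subset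
  have hτk : ∀ O' ⊆ O, O'.card = k → τ ≤ (tips O').card := by
    intro O' hO' hc
    rw [(hO.mono hO').card_tips, hc]
    exact hkM
  obtain ⟨x, hx, y, hy, z, hz, hxy, hxz, hyz⟩ := hG.exists_triangle hp hp1 hlam hτ
    (hτk O₁ hO₁ hc₁) (hτk O₂ hO₂' hc₂) (hτk O₃ hO₃' hc₃)
  obtain ⟨a, ha, hxa⟩ := mem_tips.1 hx
  obtain ⟨b, hb, hyb⟩ := mem_tips.1 hy
  obtain ⟨c, hc, hzc⟩ := mem_tips.1 hz
  have hab : a ≠ b := by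
    rintro rfl; exact (Finset.mem_sdiff.1 (hO₂ hb)).2 ha
  have hac : a ≠ c := by
    rintro rfl; exact (Finset.mem_sdiff.1 (Finset.mem_sdiff.1 (hO₃ hc)).1).2 ha
  have hbc : b ≠ c := by
    rintro rfl; exact (Finset.mem_sdiff.1 (hO₃ hc)).2 hb
  have haO := hO₁ ha
  have hbO := hO₂' hb
  have hcO := hO₃' hc
  have htri := hO.tiled_of_triangle haO hbO hcO hab hac hbc hxa hyb hzc hxy hxz hyz
  generalize hTdef : ({a, b, c} : Finset (Finset V × Finset V)) = T at htri
  have haT : a ∈ T := by simp [← hTdef]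
  have hT : T ⊆ O := by
    rw [← hTdef, Finset.insert_subset_iff, Finset.insert_subset_iff, Finset.singleton_subset_iff]
    exact ⟨haO, hbO, hcO⟩
  obtain ⟨R, hR, hRs, hRt⟩ := ih (O \ T).card (by
    rw [← hn, Finset.card_sdiff_of_subset hT]
    have := Finset.card_pos.2 ⟨a, haT⟩
    have := Finset.card_le_card hT
    omega) (hO.mono Finset.sdiff_subset) rfl
  refine ⟨R, hR.trans Finset.sdiff_subset, hRs, ?_⟩
  have heq : O \ R = ((O \ T) \ R) ∪ T := by
    rw [sdiff_right_comm, Finset.sdiff_union_of_subset]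
    exact Finset.subset_sdiff.2 ⟨hT, Finset.disjoint_of_subset_right hR Finset.disjoint_sdiff⟩
  rw [heq, verts_union]
  refine hRt.disjoint_union htri (hO.disjoint_verts
    (Finset.sdiff_subset.trans Finset.sdiff_subset) hT ?_)
  exact Finset.disjoint_of_subset_left Finset.sdiff_subset Finset.sdiff_disjoint

end Orchard

section Absorption

variable {V : Type} {G : SimpleGraph V} [DecidableRel G.Adj] [Fintype V]
  {p lam : ℝ} {τ : ℕ}

/-- The vertices with at most half of the expected number of neighbours in `Y`. -/
noncomputable def atypical (G : SimpleGraph V) [DecidableRel G.Adj] (p : ℝ)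
    (Y : Finset V) : Finset V :=
  Finset.univ.filter fun v => ((nbrs G v Y).card : ℝ) ≤ p * Y.card / 2

lemma le_card_nbrs_of_notMem_atypical {v : V} {Y : Finset V} (hv : v ∉ atypical G p Y) :
    p * Y.card / 2 ≤ (nbrs G v Y).card := by
  simp only [atypical, Finset.mem_filter, Finset.mem_univ, true_and, not_le] at hv
  exact hv.le

variable [DecidableEq V]

/-- Some triangle joins a member of the orchard `S` to members of `O₁` and `O₂` outside `U`. -/
lemma Bijumbled.exists_triangle_avoiding (hG : Bijumbled G p lam) (hp : 0 < p) (hp1 : p ≤ 1)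
    (hlam : 0 < lam) (hτ : 4 * lam ≤ p ^ 2 * τ) {M M' : ℕ} (hM : 1 ≤ M) (hM' : M' ≤ 2 * M)
    {S O₁ O₂ U : Finset (Finset V × Finset V)} (hS : IsOrchard G M S) (hSne : S.Nonempty)
    (hO : IsOrchard G M' (O₁ ∪ O₂)) (hSM : S.card * M ≤ 5 * τ)
    (h₁ : ∀ x ∈ tips S, 100 * (p * τ) ≤ (nbrs G x (tips O₁)).card)
    (h₂ : ∀ x ∈ tips S, 100 * (p * τ) ≤ (nbrs G x (tips O₂)).card)
    (hU : U.card ≤ 4 * S.card) :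
    ∃ a ∈ S, ∃ b ∈ O₁, ∃ c ∈ O₂, b ∉ U ∧ c ∉ U ∧
      ∃ x ∈ a.2, ∃ y ∈ b.2, ∃ z ∈ c.2, G.Adj x y ∧ G.Adj x z ∧ G.Adj y z := by
  have hτ0 : (0 : ℝ) < τ :=
    pos_of_mul_pos_right (lt_of_lt_of_le (by positivity) hτ) (by positivity)
  have hpτ : 0 < p * τ := by positivity
  set W := tips (U ∩ (O₁ ∪ O₂)) with hW
  have hWcard : W.card ≤ 8 * (S.card * M) := by
    rw [hW, (hO.mono Finset.inter_subset_right).card_tips]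
    have h3 := Finset.card_le_card (Finset.inter_subset_left (s₁ := U) (s₂ := O₁ ∪ O₂))
    calc _ ≤ (4 * S.card) * (2 * M) := Nat.mul_le_mul (h3.trans hU) hM'
      _ = _ := by ring
  have hWcard' : (W.card : ℝ) ≤ 8 * (S.card * M) := by exact_mod_cast hWcard
  have hSM' : (S.card : ℝ) * M ≤ 5 * τ := by exact_mod_cast hSM
  have hSpos : (0 : ℝ) < S.card * M := by
    have := hSne.card_pos
    positivity
  obtain ⟨x, hx, hxW⟩ : ∃ x ∈ tips S, ((nbrs G x W).card : ℝ) < 99 * (p * τ) := by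
    by_contra! hcon
    have h3 := hG.card_high_degree (d := 99 * (p * τ)) (by positivity) (by nlinarith) hcon
    rw [hS.card_tips] at h3
    push_cast at h3
    have h4 : (4 * lam) ^ 2 ≤ (p ^ 2 * τ) ^ 2 := pow_le_pow_left₀ (by positivity) hτ 2
    have h5 : 4 * lam ^ 2 * W.card ≤ (p ^ 2 * τ) ^ 2 / 4 * (8 * (S.card * M)) := by
      gcongr; linarith
    have h6 : p ^ 2 * (p * τ) ^ 2 ≤ 1 * (p * τ) ^ 2 := by
      gcongr; exact pow_le_one₀ hp.le hp1
    have h7 : 0 < (S.card * M : ℝ) * (p * τ) ^ 2 := by positivity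
    nlinarith [mul_le_mul_of_nonneg_left h6 hSpos.le]
  have hdeg : ∀ Y : Finset V, 100 * (p * τ) ≤ (nbrs G x Y).card →
      p * τ / 3 ≤ (nbrs G x (Y \ W)).card := by
    intro Y hY
    have h3 : ((nbrs G x Y).card : ℝ) ≤ (nbrs G x (Y \ W)).card + (nbrs G x W).card := by
      exact_mod_cast card_nbrs_le_add_sdiff x Y W
    linarith
  obtain ⟨y, hy, z, hz, hxy, hxz, hyz⟩ :=
    hG.exists_adj_nbrs hp hlam hτ (hdeg _ (h₁ x hx)) (hdeg _ (h₂ x hx))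
  rw [Finset.mem_sdiff] at hy hz
  obtain ⟨a, ha, hxa⟩ := mem_tips.1 hx
  obtain ⟨b, hb, hyb⟩ := mem_tips.1 hy.1
  obtain ⟨c, hc, hzc⟩ := mem_tips.1 hz.1
  exact ⟨a, ha, b, hb, c, hc,
    fun hbU => hy.2 (mem_tips.2 ⟨b, Finset.mem_inter.2 ⟨hbU, Finset.mem_union_left _ hb⟩, hyb⟩),
    fun hcU => hz.2 (mem_tips.2 ⟨c, Finset.mem_inter.2 ⟨hcU, Finset.mem_union_right _ hc⟩, hzc⟩),
    x, hxa, y, hyb, z, hzc, hxy, hxz, hyz⟩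

/-- A small orchard `R` can be covered together with almost all of the orchard `O₁ ∪ O₂`. -/
lemma Bijumbled.absorb (hG : Bijumbled G p lam) (hp : 0 < p) (hp1 : p ≤ 1)
    (hlam : 0 < lam) (hτ : 4 * lam ≤ p ^ 2 * τ) {M M' : ℕ} (hM : 1 ≤ M) (hM' : M' ≤ 2 * M)
    {R O₁ O₂ : Finset (Finset V × Finset V)} (hR : IsOrchard G M R)
    (hO : IsOrchard G M' (O₁ ∪ O₂)) (hO₁₂ : Disjoint O₁ O₂)
    (hRO : Disjoint (verts R) (verts (O₁ ∪ O₂))) (hRM : R.card * M ≤ 5 * τ)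
    (h₁ : ∀ x ∈ tips R, 100 * (p * τ) ≤ (nbrs G x (tips O₁)).card)
    (h₂ : ∀ x ∈ tips R, 100 * (p * τ) ≤ (nbrs G x (tips O₂)).card) :
    ∃ R' ⊆ O₁ ∪ O₂, (R'.card ≤ 2 ∨ R'.card * M' < 5 * τ) ∧
      TriangleTiled G (verts R ∪ verts ((O₁ ∪ O₂) \ R')) := by
  obtain ⟨m, hm, hmd⟩ := exists_isDisjointChoice (A := R)
    (E := fun (a : Finset V × Finset V) f => ∃ b ∈ O₁, ∃ c ∈ O₂, f = {b, c} ∧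
      ∃ x ∈ a.2, ∃ y ∈ b.2, ∃ z ∈ c.2, G.Adj x y ∧ G.Adj x z ∧ G.Adj y z)
    (by rintro a f ⟨b, -, c, -, rfl, -⟩; exact Finset.card_le_two) (by
      intro S hS hSne U hU
      have htips : tips S ⊆ tips R := Finset.biUnion_subset_biUnion_of_subset_left _ hS
      obtain ⟨a, ha, b, hb, c, hc, hbU, hcU, htri⟩ :=
        hG.exists_triangle_avoiding hp hp1 hlam hτ hM hM' (hR.mono hS) hSne hO
          ((Nat.mul_le_mul_right _ (Finset.card_le_card hS)).trans hRM)
          (fun x hx => h₁ x (htips hx)) (fun x hx => h₂ x (htips hx)) hU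
      exact ⟨a, ha, {b, c}, ⟨b, hb, c, hc, rfl, htri⟩, by simp [hbU, hcU]⟩)
  have hmO : ∀ a ∈ R, m a ⊆ O₁ ∪ O₂ := by
    intro a ha
    obtain ⟨b, hb, c, hc, hmbc, -⟩ := hm a ha
    rw [hmbc, Finset.insert_subset_iff, Finset.singleton_subset_iff]
    exact ⟨Finset.mem_union_left _ hb, Finset.mem_union_right _ hc⟩
  have hdRO : ∀ a ∈ R, ∀ T ⊆ O₁ ∪ O₂, Disjoint a.1 (verts T) := fun a ha T hT =>
    hRO.mono (Finset.subset_biUnion_of_mem Prod.fst ha) (verts_mono hT)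
  set T := R.biUnion m with hT
  have hTO : T ⊆ O₁ ∪ O₂ := Finset.biUnion_subset.2 hmO
  have hcover : TriangleTiled G (R.biUnion fun a => a.1 ∪ verts (m a)) := by
    refine TriangleTiled.biUnion (fun a ha => ?_) fun a ha a' ha' hne => ?_
    · obtain ⟨b, hb, c, hc, hmbc, x, hx, y, hy, z, hz, hxy, hxz, hyz⟩ := hm a ha
      have hbc : b ≠ c := by
        rintro rfl; exact Finset.disjoint_left.1 hO₁₂ hb hc
      have hb' := Finset.mem_union_left O₂ hb
      have hc' := Finset.mem_union_right O₁ hc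
      have hda : ∀ t ∈ O₁ ∪ O₂, Disjoint a.1 t.1 := fun t ht =>
        Finset.disjoint_of_subset_right (Finset.subset_biUnion_of_mem Prod.fst
          (Finset.mem_singleton_self t)) (hdRO a ha {t} (by simpa using ht))
      rw [hmbc, verts, Finset.biUnion_insert, Finset.singleton_biUnion]
      exact (hR.flexible a ha).tiled_of_triangle (hO.flexible b hb') (hO.flexible c hc')
        (hda b hb') (hda c hc') (hO.disjoint b hb' c hc' hbc) hx hy hz hxy hxz hyz
    · rw [Finset.disjoint_union_left, Finset.disjoint_union_right, Finset.disjoint_union_right]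
      exact ⟨⟨hR.disjoint a ha a' ha' hne, hdRO a ha _ (hmO a' ha')⟩,
        (hdRO a' ha' _ (hmO a ha)).symm,
        hO.disjoint_verts (hmO a ha) (hmO a' ha') (hmd a ha a' ha' hne)⟩
  have hcover_eq : (R.biUnion fun a => a.1 ∪ verts (m a)) = verts R ∪ verts T := by
    ext v
    simp only [hT, mem_verts, Finset.mem_biUnion, Finset.mem_union]
    constructor
    · rintro ⟨a, ha, h | ⟨t, ht, hv⟩⟩
      exacts [Or.inl ⟨a, ha, h⟩, Or.inr ⟨t, ⟨a, ha, ht⟩, hv⟩]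
    · rintro (⟨a, ha, h⟩ | ⟨t, ⟨a, ha, ht⟩, hv⟩)
      exacts [⟨a, ha, Or.inl h⟩, ⟨a, ha, Or.inr ⟨t, ht, hv⟩⟩]
  rw [hcover_eq] at hcover
  obtain ⟨R', hR', hR's, hR't⟩ := hG.exists_leftover hp hp1 hlam hτ
    (hO.mono (Finset.sdiff_subset (s := O₁ ∪ O₂) (t := T)))
  refine ⟨R', hR'.trans Finset.sdiff_subset, hR's, ?_⟩
  have heq : (O₁ ∪ O₂) \ R' = T ∪ ((O₁ ∪ O₂) \ T) \ R' := by
    rw [sdiff_right_comm, Finset.union_sdiff_of_subset]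
    exact Finset.subset_sdiff.2 ⟨hTO, Finset.disjoint_of_subset_right hR' Finset.disjoint_sdiff⟩
  have hsub : ((O₁ ∪ O₂) \ T) \ R' ⊆ O₁ ∪ O₂ := Finset.sdiff_subset.trans Finset.sdiff_subset
  rw [heq, verts_union, ← Finset.union_assoc]
  refine hcover.disjoint_union hR't (Finset.disjoint_union_left.2
    ⟨hRO.mono_right (verts_mono hsub), hO.disjoint_verts hTO hsub ?_⟩)
  exact Finset.disjoint_of_subset_right Finset.sdiff_subset Finset.disjoint_sdiff

lemma Bijumbled.card_atypical (hG : Bijumbled G p lam) (hp : 0 < p) (hlam : 0 < lam)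
    (hτ : 4 * lam ≤ p ^ 2 * τ) {Y : Finset V} (hY : 200 * τ ≤ Y.card) :
    800 * ((atypical G p Y).card : ℝ) ≤ p ^ 2 * τ := by
  have hτ0 : (0 : ℝ) < τ :=
    pos_of_mul_pos_right (lt_of_lt_of_le (by positivity) hτ) (by positivity)
  have hY' : 200 * (τ : ℝ) ≤ Y.card := by exact_mod_cast hY
  have h1 := hG.card_low_degree hp (B := atypical G p Y) (Y := Y) fun b hb =>
    (Finset.mem_filter.1 hb).2
  have h2 : p ^ 2 * (atypical G p Y).card * (200 * τ) ≤ 4 * lam ^ 2 := le_trans (by gcongr) h1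
  have h3 : (4 * lam) ^ 2 ≤ (p ^ 2 * τ) ^ 2 := pow_le_pow_left₀ (by positivity) hτ 2
  have h4 : (p ^ 2 * τ) * (800 * (atypical G p Y).card) ≤ (p ^ 2 * τ) * (p ^ 2 * τ) := by
    nlinarith
  exact le_of_mul_le_mul_left h4 (by positivity)

/-- Inside a large set `F` there is a set `A` absorbing every small orchard that is divisible
and whose removable vertices avoid a small exceptional set `Z`. -/
lemma Bijumbled.exists_absorber (hG : Bijumbled G p lam) (hp : 0 < p) (hp1 : p ≤ 1)
    (hlam : 0 < lam) (hτ : 4 * lam ≤ p ^ 2 * τ) (s : ℕ) :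
    ∀ (M : ℕ) (F : Finset V), 1 ≤ M → 2 * τ ≤ M * 2 ^ s → s * (1300 * τ) ≤ F.card →
      ∃ A ⊆ F, ∃ Z : Finset V, (Z.card : ℝ) ≤ p ^ 2 * τ ∧
        ∀ R, IsOrchard G M R → Disjoint (verts R) A → Disjoint (tips R) Z →
          (R.card ≤ 2 ∨ R.card * M < 5 * τ) → 3 ∣ (verts R).card + A.card →
          TriangleTiled G (verts R ∪ A) := by
  have hτ0 : (0 : ℝ) < τ :=
    pos_of_mul_pos_right (lt_of_lt_of_le (by positivity) hτ) (by positivity)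
  have hτ1 : 1 ≤ τ := by exact_mod_cast hτ0
  have hbase : ∀ (M : ℕ) (F : Finset V), 2 * τ ≤ M →
      ∃ A ⊆ F, ∃ Z : Finset V, (Z.card : ℝ) ≤ p ^ 2 * τ ∧
        ∀ R, IsOrchard G M R → Disjoint (verts R) A → Disjoint (tips R) Z →
          (R.card ≤ 2 ∨ R.card * M < 5 * τ) → 3 ∣ (verts R).card + A.card →
          TriangleTiled G (verts R ∪ A) := by
    intro M F hM
    refine ⟨∅, Finset.empty_subset _, ∅, by simp; positivity, fun R hR _ _ hRs hdvd => ?_⟩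
    have hR2 : R.card ≤ 2 := by
      rcases hRs with h | h
      · exact h
      · by_contra! hcon
        have : 3 * (2 * τ) ≤ R.card * M := Nat.mul_le_mul hcon hM
        omega
    have hv := hR.card_verts
    rw [Finset.card_empty, add_zero] at hdvd
    have hR0 : R.card = 0 := by omega
    rw [Finset.card_eq_zero.1 hR0]
    simpa [verts] using TriangleTiled.empty
  induction s with
  | zero => intro M F _ hM _; exact hbase M F (by simpa using hM)
  | succ s ih =>
    intro M F hM1 hMs hF
    by_cases hM : 2 * τ ≤ M
    · exact hbase M F hM
    push Not at hM
    rw [add_one_mul] at hF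
    obtain ⟨W, hWF, hWc⟩ := Finset.exists_subset_card_eq (s := F) (n := 1300 * τ) (by omega)
    have hFW := Finset.card_sdiff_of_subset hWF
    obtain ⟨A', hA'F, Z', hZ', habs⟩ := ih (2 * M) (F \ W) (by omega)
      (by rw [pow_succ] at hMs; linarith) (by omega)
    have hZ'τ : Z'.card ≤ τ := by
      have : (Z'.card : ℝ) ≤ 1 * τ := hZ'.trans (by gcongr; exact pow_le_one₀ hp.le hp1)
      exact_mod_cast (one_mul (τ : ℝ)) ▸ this
    have hWZ := Finset.le_card_sdiff Z' W
    obtain ⟨N, hN1, hN2⟩ : ∃ N : ℕ, 200 * τ ≤ N * (2 * M) ∧ N * (2 * M) ≤ 204 * τ := by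
      refine ⟨200 * τ / (2 * M) + 1, ?_, ?_⟩
      · have := Nat.lt_div_mul_add (a := 200 * τ) (show 0 < 2 * M by omega)
        rw [add_one_mul]; omega
      · have := Nat.div_mul_le_self (200 * τ) (2 * M)
        rw [add_one_mul]; omega
    obtain ⟨O, hO, hOc, hOW⟩ := hG.exists_isOrchard hp hp1 hlam hτ (M := 2 * M) (by omega)
      (Y := W \ Z') (2 * N) (by rw [mul_assoc]; omega)
    obtain ⟨O₁, hO₁, hc₁⟩ := Finset.exists_subset_card_eq (s := O) (n := N) (by omega)
    have hunion : O₁ ∪ O \ O₁ = O := Finset.union_sdiff_of_subset hO₁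
    have hc₂ : (O \ O₁).card = N := by rw [Finset.card_sdiff_of_subset hO₁]; omega
    have ht₁ : 200 * τ ≤ (tips O₁).card := by rwa [(hO.mono hO₁).card_tips, hc₁]
    have ht₂ : 200 * τ ≤ (tips (O \ O₁)).card := by
      rwa [(hO.mono Finset.sdiff_subset).card_tips, hc₂]
    have hOA' : Disjoint (verts O) A' := Finset.disjoint_of_subset_left
      (hOW.trans Finset.sdiff_subset) (Finset.disjoint_of_subset_right hA'F Finset.disjoint_sdiff)
    refine ⟨verts O ∪ A', Finset.union_subset ((hOW.trans Finset.sdiff_subset).trans hWF)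
      (hA'F.trans Finset.sdiff_subset),
      atypical G p (tips O₁) ∪ atypical G p (tips (O \ O₁)), ?_, ?_⟩
    · have h1 := hG.card_atypical hp hlam hτ ht₁
      have h2 := hG.card_atypical hp hlam hτ ht₂
      have h3 : ((atypical G p (tips O₁) ∪ atypical G p (tips (O \ O₁))).card : ℝ) ≤
          (atypical G p (tips O₁)).card + (atypical G p (tips (O \ O₁))).card := by
        exact_mod_cast Finset.card_union_le _ _
      have h4 : 0 < p ^ 2 * τ := by positivity
      linarith
    · intro R hR hRA hRZ hRs hdvd
      rw [Finset.disjoint_union_right] at hRA hRZ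
      have hRM : R.card * M ≤ 5 * τ := by
        rcases hRs with h | h
        · have := Nat.mul_le_mul h hM.le
          omega
        · exact h.le
      have hdeg : ∀ Y : Finset V, 200 * τ ≤ Y.card → Disjoint (tips R) (atypical G p Y) →
          ∀ x ∈ tips R, 100 * (p * τ) ≤ (nbrs G x Y).card := by
        intro Y hY hYR x hx
        have h1 := le_card_nbrs_of_notMem_atypical (Finset.disjoint_left.1 hYR hx)
        have h2 : 200 * (τ : ℝ) ≤ Y.card := by exact_mod_cast hY
        nlinarith
      obtain ⟨R', hR', hR's, hR't⟩ := hG.absorb hp hp1 hlam hτ hM1 le_rfl hR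
        (O₁ := O₁) (O₂ := O \ O₁) (by rwa [hunion]) Finset.disjoint_sdiff
        (by rw [hunion]; exact hRA.1) hRM (hdeg _ ht₁ hRZ.1) (hdeg _ ht₂ hRZ.2)
      rw [hunion] at hR' hR't
      have hsplit := verts_sdiff_union hR'
      have hdR' : Disjoint (verts (O \ R')) (verts R') :=
        hO.disjoint_verts Finset.sdiff_subset hR' Finset.sdiff_disjoint
      have hdRO : Disjoint (verts R) (verts (O \ R')) :=
        hRA.1.mono_right (verts_mono Finset.sdiff_subset)
      have hR'A' : Disjoint (verts R') A' := hOA'.mono_left (verts_mono hR')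
      have h3 := hR't.three_dvd_card
      rw [Finset.card_union_of_disjoint hdRO] at h3
      have hcO := Finset.card_union_of_disjoint hdR'
      rw [hsplit] at hcO
      rw [Finset.card_union_of_disjoint hOA', hcO] at hdvd
      have hfin := habs R' (hO.mono hR') hR'A' ?_ hR's (by omega)
      · have heq : verts R ∪ (verts O ∪ A') =
            (verts R ∪ verts (O \ R')) ∪ (verts R' ∪ A') := by
          rw [← hsplit]; simp only [Finset.union_assoc]
        rw [heq]
        refine hR't.disjoint_union hfin ?_
        rw [Finset.disjoint_union_left, Finset.disjoint_union_right, Finset.disjoint_union_right]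
        exact ⟨⟨hRA.1.mono_right (verts_mono hR'), hRA.2⟩, hdR',
          hOA'.mono_left (verts_mono Finset.sdiff_subset)⟩
      · refine Finset.disjoint_of_subset_left ((hO.mono hR').tips_subset_verts.trans
          ((verts_mono hR').trans hOW)) Finset.sdiff_disjoint

end Absorption

section Main

variable {V : Type} [DecidableEq V] {G : SimpleGraph V} [DecidableRel G.Adj] [Fintype V]
  {p lam : ℝ} {τ : ℕ}

/-- A small set of vertices of large degree is covered greedily by disjoint triangles. -/
lemma Bijumbled.exists_cover (hG : Bijumbled G p lam) (hp : 0 < p) (hlam : 0 < lam)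
    (hτ : 4 * lam ≤ p ^ 2 * τ) (Z : Finset V)
    (hZ : ∀ v, p * τ / 3 + 3 * Z.card ≤ (nbrs G v Finset.univ).card) :
    ∃ T, Z ⊆ T ∧ TriangleTiled G T ∧ T.card ≤ 3 * Z.card := by
  induction Z using Finset.induction_on with
  | empty => exact ⟨∅, subset_rfl, TriangleTiled.empty, by simp⟩
  | insert z Z hz ih =>
    rw [Finset.card_insert_of_notMem hz] at hZ ⊢
    push_cast at hZ
    obtain ⟨T, hZT, hT, hTc⟩ := ih fun v => by linarith [hZ v]
    by_cases hzT : z ∈ T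
    · exact ⟨T, Finset.insert_subset hzT hZT, hT, by omega⟩
    have hdeg : p * τ / 3 ≤ (nbrs G z (Finset.univ \ T)).card := by
      have h1 : ((nbrs G z Finset.univ).card : ℝ) ≤
          (nbrs G z (Finset.univ \ T)).card + (nbrs G z T).card := by
        exact_mod_cast card_nbrs_le_add_sdiff z Finset.univ T
      have h2 : ((nbrs G z T).card : ℝ) ≤ 3 * Z.card := by
        exact_mod_cast (Finset.card_filter_le _ _).trans hTc
      linarith [hZ z]
    obtain ⟨x, hx, y, hy, hzx, hzy, hxy⟩ := hG.exists_adj_nbrs hp hlam hτ hdeg hdeg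
    rw [Finset.mem_sdiff] at hx hy
    have hcl : G.IsNClique 3 {z, x, y} :=
      SimpleGraph.is3Clique_iff.2 ⟨z, x, y, hzx, hzy, hxy, rfl⟩
    refine ⟨T ∪ {z, x, y}, ?_, hT.union hcl (by simp [hzT, hx.2, hy.2]), ?_⟩
    · exact Finset.insert_subset (by simp) (hZT.trans Finset.subset_union_left)
    · have := Finset.card_union_le T {z, x, y}
      rw [hcl.card_eq] at this
      omega

/-- Splitting two parts of a three-part cover of the vertex set and regrouping the pieces. -/
lemma union_eq_univ_of_eq_sdiff {A T O Q Q₁ Q₂ O₁ O₂ : Finset V}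
    (hQ : Q = Finset.univ \ (A ∪ T ∪ O)) (hQ₁₂ : Q₁ ∪ Q₂ = Q) (hO₁₂ : O₁ ∪ O₂ = O) :
    (T ∪ Q₁ ∪ (Q₂ ∪ O₁)) ∪ (O₂ ∪ A) = Finset.univ := by
  have h : A ∪ T ∪ O ∪ Q = Finset.univ := by
    rw [hQ, Finset.union_sdiff_of_subset (Finset.subset_univ _)]
  rw [← h, ← hQ₁₂, ← hO₁₂]
  ac_rfl

theorem Bijumbled.triangleTiled_univ (hG : Bijumbled G p lam) (hp : 0 < p) (hp1 : p ≤ 1)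
    (hlam : 0 < lam) (hτ : 4 * lam ≤ p ^ 2 * τ) {s : ℕ} (hs : 2 * τ ≤ 2 ^ s)
    (hn : (s + 3) * (1300 * τ) ≤ Fintype.card V) (h3 : 3 ∣ Fintype.card V)
    (hdeg : ∀ v, p * τ ≤ (nbrs G v Finset.univ).card) :
    TriangleTiled G (Finset.univ : Finset V) := by
  have hτ0 : (0 : ℝ) < τ :=
    pos_of_mul_pos_right (lt_of_lt_of_le (by positivity) hτ) (by positivity)
  have hτ1 : 1 ≤ τ := by exact_mod_cast hτ0
  have hpτ : 0 < p * τ := by positivity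
  have hp2 : p ^ 2 * τ ≤ p * τ := by nlinarith
  have hpτ' : p * τ ≤ τ := by nlinarith
  rw [add_mul] at hn
  obtain ⟨W₁, hW₁, hc₁⟩ := Finset.exists_subset_card_eq (s := (Finset.univ : Finset V))
    (n := 1300 * τ) (by rw [Finset.card_univ]; omega)
  have hcW₁ := Finset.card_sdiff_of_subset hW₁
  rw [Finset.card_univ, hc₁] at hcW₁
  obtain ⟨W₂, hW₂, hc₂⟩ := Finset.exists_subset_card_eq (s := Finset.univ \ W₁)
    (n := 1300 * τ) (by omega)
  have hW₁₂ : Disjoint W₁ W₂ := Finset.disjoint_of_subset_right hW₂ Finset.disjoint_sdiff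
  have hat₁ := hG.card_atypical hp hlam hτ (Y := W₁) (by omega)
  have hat₂ := hG.card_atypical hp hlam hτ (Y := W₂) (by omega)
  set Z₁ := atypical G p W₁ ∪ atypical G p W₂ with hZ₁
  have hZ₁c : 400 * (Z₁.card : ℝ) ≤ p ^ 2 * τ := by
    have : (Z₁.card : ℝ) ≤ (atypical G p W₁).card + (atypical G p W₂).card := by
      exact_mod_cast Finset.card_union_le _ _
    linarith
  obtain ⟨T, hZT, hT, hTc⟩ := hG.exists_cover hp hlam hτ Z₁ fun v => by linarith [hdeg v]
  have hTc' : (T.card : ℝ) ≤ 3 * Z₁.card := by exact_mod_cast hTc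
  have hTτ : T.card ≤ τ := by
    have : (T.card : ℝ) ≤ τ := by linarith
    exact_mod_cast this
  obtain ⟨A, hAF, Z, hZ, habs⟩ := hG.exists_absorber hp hp1 hlam hτ s 1
    (((Finset.univ \ W₁) \ W₂) \ T) le_rfl (by omega) (by
      have h1 := Finset.le_card_sdiff T ((Finset.univ \ W₁) \ W₂)
      have h2 := Finset.card_sdiff_of_subset hW₂
      omega)
  have hA : ∀ v ∈ A, v ∉ W₁ ∧ v ∉ W₂ ∧ v ∉ T := by
    intro v hv
    have := hAF hv
    simp only [Finset.mem_sdiff, Finset.mem_univ, true_and] at this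
    tauto
  set O₁ := W₁ \ (T ∪ Z) with hO₁
  set O₂ := W₂ \ (T ∪ Z) with hO₂
  have hO₁₂ : Disjoint O₁ O₂ := hW₁₂.mono Finset.sdiff_subset Finset.sdiff_subset
  have hO : ∀ v ∈ O₁ ∪ O₂, v ∉ T ∧ v ∉ Z ∧ v ∉ A := by
    intro v hv
    simp only [hO₁, hO₂, Finset.mem_union, Finset.mem_sdiff, not_or] at hv
    refine ⟨by tauto, by tauto, fun hvA => ?_⟩
    have := hA v hvA
    tauto
  have hOdeg : ∀ W : Finset V, W.card = 1300 * τ → ∀ v ∉ atypical G p W,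
      100 * (p * τ) ≤ (nbrs G v (W \ (T ∪ Z))).card := by
    intro W hW v hv
    have h1 := le_card_nbrs_of_notMem_atypical hv
    have h2 : ((nbrs G v W).card : ℝ) ≤
        (nbrs G v (W \ (T ∪ Z))).card + (nbrs G v (T ∪ Z)).card := by
      exact_mod_cast card_nbrs_le_add_sdiff v W (T ∪ Z)
    have h3 : ((nbrs G v (T ∪ Z)).card : ℝ) ≤ T.card + Z.card := by
      exact_mod_cast (Finset.card_filter_le _ _).trans (Finset.card_union_le _ _)
    rw [hW] at h1
    push_cast at h1
    linarith
  set Q := Finset.univ \ (A ∪ T ∪ (O₁ ∪ O₂)) with hQ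
  have hQmem : ∀ v ∈ Q, v ∉ A ∧ v ∉ T ∧ v ∉ O₁ ∪ O₂ := by
    intro v hv
    simp only [hQ, Finset.mem_sdiff, Finset.mem_univ, true_and, Finset.mem_union] at hv ⊢
    tauto
  obtain ⟨R, hRQ, hRs, hRt⟩ := hG.exists_leftover hp hp1 hlam hτ (isOrchard_singletons (G := G) Q)
  have hR := (isOrchard_singletons (G := G) Q).mono hRQ
  have hRvQ : verts R ⊆ Q := (verts_mono hRQ).trans (verts_singletons Q).subset
  have hRQ' : verts (singletons Q \ R) ⊆ Q :=
    (verts_mono Finset.sdiff_subset).trans (verts_singletons Q).subset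
  have hRdeg : ∀ x ∈ tips R, x ∉ Z₁ := fun x hx hxZ =>
    (hQmem x (hRvQ (hR.tips_subset_verts hx))).2.1 (hZT hxZ)
  obtain ⟨R', hR'O, hR's, hR't⟩ := hG.absorb hp hp1 hlam hτ le_rfl one_le_two hR
    (O₁ := singletons O₁) (O₂ := singletons O₂)
    (by rw [← singletons_union]; exact isOrchard_singletons _) (disjoint_singletons hO₁₂)
    (by
      rw [← singletons_union, verts_singletons, Finset.disjoint_left]
      exact fun v hv => (hQmem v (hRvQ hv)).2.2)
    (by rcases hRs with h | h <;> omega)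
    (fun x hx => by
      rw [tips_singletons]
      exact hOdeg W₁ hc₁ x fun hc => hRdeg x hx (Finset.mem_union_left _ hc))
    (fun x hx => by
      rw [tips_singletons]
      exact hOdeg W₂ hc₂ x fun hc => hRdeg x hx (Finset.mem_union_right _ hc))
  rw [← singletons_union] at hR'O hR't
  have hS := isOrchard_singletons (G := G) (O₁ ∪ O₂)
  have hR' := hS.mono hR'O
  have hR'v : verts R' ⊆ O₁ ∪ O₂ := (verts_mono hR'O).trans (verts_singletons _).subset
  have hsplitQ := verts_sdiff_union hRQ
  have hsplitO := verts_sdiff_union hR'O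
  rw [verts_singletons] at hsplitQ hsplitO
  have hdQ : Disjoint (verts (singletons Q \ R)) (verts R) :=
    (isOrchard_singletons (G := G) Q).disjoint_verts Finset.sdiff_subset hRQ Finset.sdiff_disjoint
  have hdO : Disjoint (verts (singletons (O₁ ∪ O₂) \ R')) (verts R') :=
    hS.disjoint_verts Finset.sdiff_subset hR'O Finset.sdiff_disjoint
  have hOO : verts (singletons (O₁ ∪ O₂) \ R') ⊆ O₁ ∪ O₂ :=
    (verts_mono Finset.sdiff_subset).trans (verts_singletons _).subset
  have hR'A : Disjoint (verts R') A := Finset.disjoint_left.2 fun v hv => (hO v (hR'v hv)).2.2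
  have hTQ : Disjoint T (verts (singletons Q \ R)) :=
    Finset.disjoint_right.2 fun v hv => (hQmem v (hRQ' hv)).2.1
  have hcover₁ := hT.disjoint_union hRt hTQ
  have hcover₂ := hcover₁.disjoint_union hR't (by
    rw [Finset.disjoint_union_right]
    constructor
    · exact Finset.disjoint_union_left.2
        ⟨Finset.disjoint_right.2 fun v hv => (hQmem v (hRvQ hv)).2.1, hdQ⟩
    · exact Finset.disjoint_union_left.2
        ⟨Finset.disjoint_right.2 fun v hv => (hO v (hOO hv)).1,
          Finset.disjoint_left.2 fun v hv hv' => (hQmem v (hRQ' hv)).2.2 (hOO hv')⟩)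
  have hdis : Disjoint (T ∪ verts (singletons Q \ R) ∪
      (verts R ∪ verts (singletons (O₁ ∪ O₂) \ R'))) (verts R' ∪ A) := by
    have h1 : ∀ v ∈ Q, v ∉ verts R' ∪ A := fun v hv hv' =>
      (Finset.mem_union.1 hv').elim (fun h => (hQmem v hv).2.2 (hR'v h)) (hQmem v hv).1
    have h2 : Disjoint T (verts R' ∪ A) := Finset.disjoint_right.2 fun v hv =>
      (Finset.mem_union.1 hv).elim (fun h => (hO v (hR'v h)).1) fun h => (hA v h).2.2
    have h4 : Disjoint (verts (singletons (O₁ ∪ O₂) \ R')) A :=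
      Finset.disjoint_left.2 fun v hv => (hO v (hOO hv)).2.2
    rw [Finset.disjoint_union_left, Finset.disjoint_union_left, Finset.disjoint_union_left]
    exact ⟨⟨h2, Finset.disjoint_left.2 fun v hv => h1 v (hRQ' hv)⟩,
      Finset.disjoint_left.2 fun v hv => h1 v (hRvQ hv), Finset.disjoint_union_right.2 ⟨hdO, h4⟩⟩
  have huniv : (T ∪ verts (singletons Q \ R) ∪
      (verts R ∪ verts (singletons (O₁ ∪ O₂) \ R'))) ∪ (verts R' ∪ A) = Finset.univ :=
    union_eq_univ_of_eq_sdiff hQ hsplitQ hsplitO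
  have hdvd : 3 ∣ (verts R').card + A.card := by
    have h1 := hcover₂.three_dvd_card
    have h2 := Finset.card_union_of_disjoint hdis
    rw [huniv, Finset.card_univ, Finset.card_union_of_disjoint hR'A] at h2
    omega
  rw [← huniv]
  refine hcover₂.disjoint_union (habs R' hR' hR'A ?_ hR's hdvd) hdis
  exact Finset.disjoint_left.2 fun v hv => (hO v (hR'v (hR'.tips_subset_verts hv))).2.1

end Main

section Parameters

/-- A power of two just above `2 * n` has an exponent of order `log n`. -/
lemma exists_two_mul_le_two_pow {n : ℕ} (hn : 3 ≤ n) :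
    ∃ s : ℕ, 2 * n ≤ 2 ^ s ∧ (s : ℝ) + 3 ≤ 7 * Real.log n := by
  have hL : 1 ≤ Real.log n := by
    rw [Real.le_log_iff_exp_le (by positivity)]
    have : (3 : ℝ) ≤ n := by exact_mod_cast hn
    linarith [Real.exp_one_lt_d9]
  refine ⟨Nat.log 2 n + 2, ?_, ?_⟩
  · have := Nat.lt_pow_succ_log_self one_lt_two n
    rw [pow_succ] at this ⊢
    omega
  · have h : ((2 : ℝ) ^ Nat.log 2 n) ≤ n := by
      exact_mod_cast Nat.pow_log_le_self 2 (by omega)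
    have h' := Real.log_le_log (by positivity) h
    rw [Real.log_pow] at h'
    push_cast
    nlinarith [Real.log_two_gt_d9, (Nat.cast_nonneg (Nat.log 2 n) : (0 : ℝ) ≤ _)]

lemma Bijumbled.lt_of_vertex {V : Type} [Fintype V] [DecidableEq V] {G : SimpleGraph V}
    [DecidableRel G.Adj] {p lam : ℝ} (hG : Bijumbled G p lam) (v : V) : p < lam := by
  have h := hG {v} {v} (by simp) (by simp)
  have h0 : ePairs G {v} {v} = 0 := by simp [ePairs]
  rw [h0] at h
  simp only [Finset.card_singleton, Nat.cast_zero, Nat.cast_one, mul_one, zero_sub,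
    Real.sqrt_one, abs_neg] at h
  exact (le_abs_self p).trans_lt h

end Parameters

/-- for every `δ > 0` there is `ε > 0` such that for every `p ∈ (0,1]`,
every `(p,λ)`-bijumbled graph `G` on `n` vertices with `3 ∣ n`, `λ ≤ ε p² n / log n`
and minimum degree at least `δ p n` contains a triangle-factor: `n/3` vertex-disjoint
triangles covering all vertices. -/
theorem stmt2 (δ : ℝ) (hδ : 0 < δ) :
    ∃ ε : ℝ, 0 < ε ∧ ∀ p : ℝ, 0 < p → p ≤ 1 →
    ∀ (V : Type) [Fintype V] [DecidableEq V] (G : SimpleGraph V) [DecidableRel G.Adj]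
      (n : ℕ), Fintype.card V = n → 3 ∣ n →
      ∀ lam : ℝ, lam ≤ ε * p ^ 2 * n / Real.log n → Bijumbled G p lam →
      (∀ v : V, δ * p * n ≤ (G.degree v : ℝ)) →
      ∃ P : Finset (Finset V),
        (∀ s ∈ P, G.IsNClique 3 s) ∧
        (P : Set (Finset V)).Pairwise (fun s t => Disjoint s t) ∧
        P.biUnion id = Finset.univ ∧
        P.card = n / 3 := by
  obtain ⟨C, hC, hCδ⟩ : ∃ C : ℝ, 10000 ≤ C ∧ 3 ≤ C * δ :=
    ⟨10000 + 3 / δ, by linarith [div_pos (three_pos (α := ℝ)) hδ], by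
      rw [add_mul, div_mul_cancel₀ _ hδ.ne']
      linarith⟩
  refine ⟨1 / (8 * C), by positivity, ?_⟩
  intro p hp hp1 V _ _ G _ n hcard h3 lam hlam hG hdeg
  suffices h : TriangleTiled G (Finset.univ : Finset V) by
    obtain ⟨P, hP, hdis, hU⟩ := h.exists_partition
    refine ⟨P, hP, hdis, hU, ?_⟩
    have h1 := Finset.card_biUnion (s := P) (t := id) fun s hs t ht hst => hdis hs ht hst
    rw [hU, Finset.card_univ, hcard,
      Finset.sum_congr rfl fun s hs => (show (id s).card = 3 from (hP s hs).card_eq),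
      Finset.sum_const, smul_eq_mul] at h1
    omega
  rcases isEmpty_or_nonempty V with hV | ⟨⟨v⟩⟩
  · rw [Finset.univ_eq_empty]
    exact TriangleTiled.empty
  have hn3 : 3 ≤ n := Nat.le_of_dvd (hcard ▸ Fintype.card_pos_iff.2 ⟨v⟩) h3
  have hn0 : (0 : ℝ) < n := by positivity
  obtain ⟨s, hs, hsL⟩ := exists_two_mul_le_two_pow hn3
  have hL : 0 < Real.log n := Real.log_pos (by exact_mod_cast (by omega : 1 < n))
  have hpl := hG.lt_of_vertex v
  set x : ℝ := n / (C * Real.log n) with hx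
  have hxn : x * (C * Real.log n) = n := div_mul_cancel₀ _ (by positivity)
  have hlamx : 8 * lam ≤ p ^ 2 * x := by
    have : 1 / (8 * C) * p ^ 2 * n / Real.log n = p ^ 2 * x / 8 := by
      rw [hx]
      field_simp
    linarith
  have hx0 : 0 < x := by positivity
  have hx8 : 8 ≤ x := by
    have h1 : 8 * p < p * (p * x) := by linarith
    have h2 : 8 < p * x := by nlinarith
    nlinarith
  have hτx : (⌊x⌋₊ : ℝ) ≤ x := Nat.floor_le hx0.le
  have hτx' : x / 2 ≤ ⌊x⌋₊ := by linarith [Nat.lt_floor_add_one x]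
  have hL1 : 3 / 7 ≤ Real.log n := by linarith [(Nat.cast_nonneg s : (0 : ℝ) ≤ s)]
  have hτn : ((s + 3) * (1300 * ⌊x⌋₊) : ℝ) ≤ n := by
    calc ((s + 3) * (1300 * ⌊x⌋₊) : ℝ) ≤ (7 * Real.log n) * (1300 * x) := by gcongr
      _ = x * (9100 * Real.log n) := by ring
      _ ≤ x * (C * Real.log n) := by gcongr; linarith
      _ = n := hxn
  have hτle : ⌊x⌋₊ ≤ n := by
    have : (⌊x⌋₊ : ℝ) ≤ n := by nlinarith [(Nat.cast_nonneg s : (0 : ℝ) ≤ s)]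
    exact_mod_cast this
  refine hG.triangleTiled_univ (τ := ⌊x⌋₊) (s := s) hp hp1 (hp.trans hpl) ?_ (by omega) ?_
    (hcard ▸ h3) fun v => ?_
  · nlinarith [pow_pos hp 2]
  · rw [hcard]
    exact_mod_cast hτn
  · have hd : G.degree v = (nbrs G v Finset.univ).card := by
      rw [← SimpleGraph.card_neighborFinset_eq_degree, SimpleGraph.neighborFinset_eq_filter]
      rfl
    rw [← hd]
    refine le_trans ?_ (hdeg v)
    have hxδ : x ≤ δ * n := by
      rw [← hxn, mul_comm δ, mul_assoc, mul_right_comm C]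
      exact le_mul_of_one_le_right hx0.le (by nlinarith)
    nlinarith
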